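/- Let φ > 0 and let α : I → ℝ³ be a smooth time-like curve parameterized by arc length with curvature κ ≡ 1 (N := α′′, ⟨N,N⟩ ≡ 1), B := α′ ×_L N, defined on an interval I ⊆ (tanh(φ), ∞), and suppose its torsion τ := ⟨N′,B⟩ satisfies τ(s) = s/√(s² − tanh²(φ)) for all s ∈ I. Then the vector field d(s) := cosh(φ)·( −s·T(s) + N(s) − √(s² − tanh²(φ))·B(s) ) has vanishing derivative on I (so d is a constant vector), and moreover ⟨d, d⟩ = 1 and ⟨N(s), d⟩ = cosh(φ) for all s ∈ I; hence the normal vectors of α make the constant hyperbolic angle φ with a fixed space-like direction. -/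

import Mathlib

/- Minkowski 3-space: ℝ³ with the bilinear form ⟨u,v⟩ = -u₁v₁ + u₂v₂ + u₃v₃. -/

noncomputable section

/-- The Minkowski bilinear form on ℝ³. -/
def mink (u v : Fin 3 → ℝ) : ℝ := -(u 0 * v 0) + u 1 * v 1 + u 2 * v 2

/-- The Minkowski norm ‖v‖ = √|⟨v,v⟩|. -/
def mnorm (u : Fin 3 → ℝ) : ℝ := Real.sqrt |mink u u|

/-- The Lorentzian cross product u ×_L v. -/
def lcross (u v : Fin 3 → ℝ) : Fin 3 → ℝ :=
  ![u 1 * v 2 - u 2 * v 1, u 0 * v 2 - u 2 * v 0, u 1 * v 0 - u 0 * v 1]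

/-- n = m / √(m² - 1). -/
def nval (m : ℝ) : ℝ := m / Real.sqrt (m ^ 2 - 1)

/-- For a unit-speed time-like curve with κ ≡ 1: principal normal N = α''. -/
def Narc (α : ℝ → Fin 3 → ℝ) (s : ℝ) : Fin 3 → ℝ := deriv (deriv α) s

/-- Binormal B = α' ×_L α''. -/
def Barc (α : ℝ → Fin 3 → ℝ) (s : ℝ) : Fin 3 → ℝ := lcross (deriv α s) (Narc α s)

/-- Torsion τ = ⟨N', B⟩. -/
def tauArc (α : ℝ → Fin 3 → ℝ) (s : ℝ) : ℝ := mink (deriv (Narc α) s) (Barc α s)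

lemma mink_eq_zero_aux (u v x : Fin 3 → ℝ) (h1 : mink x u = 0) (h2 : mink x v = 0)
    (h3 : mink x (lcross u v) = 0) (h4 : mink (lcross u v) (lcross u v) = 1) : x = 0 := by
  have h5 : ∀ i, x i * mink (lcross u v) (lcross u v) = (mink x u * lcross v (lcross u v) i
      + mink x v * lcross (lcross u v) u i) + mink x (lcross u v) * lcross u v i := by
    intro i
    fin_cases i <;> simp [mink, lcross] <;> ring
  funext i
  have h := h5 i
  rw [h1, h2, h3, h4] at h
  simpa using h

lemma mink_hasDerivAt {f g : ℝ → Fin 3 → ℝ} {f' g' : Fin 3 → ℝ} {s : ℝ}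
    (hf : HasDerivAt f f' s) (hg : HasDerivAt g g' s) :
    HasDerivAt (fun u => mink (f u) (g u)) (mink f' (g s) + mink (f s) g') s := by
  have hf := hasDerivAt_pi.1 hf
  have hg := hasDerivAt_pi.1 hg
  unfold mink
  refine HasDerivAt.congr_deriv
    ((((hf 0).mul (hg 0)).neg.add ((hf 1).mul (hg 1))).add ((hf 2).mul (hg 2))) ?_
  ring

lemma lcross_hasDerivAt {f g : ℝ → Fin 3 → ℝ} {f' g' : Fin 3 → ℝ} {s : ℝ}
    (hf : HasDerivAt f f' s) (hg : HasDerivAt g g' s) :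
    HasDerivAt (fun u => lcross (f u) (g u)) (lcross f' (g s) + lcross (f s) g') s := by
  have hf := hasDerivAt_pi.1 hf
  have hg := hasDerivAt_pi.1 hg
  rw [hasDerivAt_pi]
  intro i
  fin_cases i
  · refine HasDerivAt.congr_deriv (((hf 1).mul (hg 2)).sub ((hf 2).mul (hg 1))) ?_
    simp [lcross]; ring
  · refine HasDerivAt.congr_deriv (((hf 0).mul (hg 2)).sub ((hf 2).mul (hg 0))) ?_
    simp [lcross]; ring
  · refine HasDerivAt.congr_deriv (((hf 1).mul (hg 0)).sub ((hf 0).mul (hg 1))) ?_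
    simp [lcross]; ring

lemma mink_const_deriv {a b c s : ℝ} {F : ℝ → ℝ} {F' : ℝ} (hs : s ∈ Set.Ioo a b)
    (h : ∀ u ∈ Set.Ioo a b, F u = c) (hF : HasDerivAt F F' s) : F' = 0 := by
  have h1 : F =ᶠ[nhds s] fun _ => c := by
    filter_upwards [isOpen_Ioo.mem_nhds hs] with u hu using h u hu
  exact hF.unique ((hasDerivAt_const s c).congr_of_eventuallyEq h1)

/-- converse direction. If a unit-speed time-like curve with κ ≡ 1 on
I ⊆ (tanh φ, ∞) has torsion τ(s) = s/√(s² - tanh²φ), then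
d(s) = cosh φ·(-s·T(s) + N(s) - √(s² - tanh²φ)·B(s)) is a constant vector with
⟨d,d⟩ = 1 and ⟨N(s),d⟩ = cosh φ. -/
theorem constant_direction_of_torsion (a b : ℝ) (α : ℝ → Fin 3 → ℝ) (φ : ℝ)
    (hφ : 0 < φ) (hab : a < b)
    (hI : Set.Ioo a b ⊆ Set.Ioi (Real.tanh φ))
    (hsmooth : ContDiffOn ℝ (⊤ : ℕ∞) α (Set.Ioo a b))
    (hunit : ∀ s ∈ Set.Ioo a b, mink (deriv α s) (deriv α s) = -1)
    (hcurv : ∀ s ∈ Set.Ioo a b, mink (Narc α s) (Narc α s) = 1)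
    (htau : ∀ s ∈ Set.Ioo a b,
        tauArc α s = s / Real.sqrt (s ^ 2 - Real.tanh φ ^ 2)) :
    (∀ s ∈ Set.Ioo a b,
      deriv (fun u : ℝ => Real.cosh φ •
        ((-u) • deriv α u + Narc α u
          - Real.sqrt (u ^ 2 - Real.tanh φ ^ 2) • Barc α u)) s = 0) ∧
    (∀ s ∈ Set.Ioo a b, ∀ s' ∈ Set.Ioo a b,
      Real.cosh φ • ((-s) • deriv α s + Narc α s
          - Real.sqrt (s ^ 2 - Real.tanh φ ^ 2) • Barc α s)
        = Real.cosh φ • ((-s') • deriv α s' + Narc α s'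
          - Real.sqrt (s' ^ 2 - Real.tanh φ ^ 2) • Barc α s')) ∧
    (∀ s ∈ Set.Ioo a b,
      mink (Real.cosh φ • ((-s) • deriv α s + Narc α s
          - Real.sqrt (s ^ 2 - Real.tanh φ ^ 2) • Barc α s))
        (Real.cosh φ • ((-s) • deriv α s + Narc α s
          - Real.sqrt (s ^ 2 - Real.tanh φ ^ 2) • Barc α s)) = 1) ∧
    (∀ s ∈ Set.Ioo a b,
      mink (Narc α s)
        (Real.cosh φ • ((-s) • deriv α s + Narc α s
          - Real.sqrt (s ^ 2 - Real.tanh φ ^ 2) • Barc α s)) = Real.cosh φ) := by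
  have hT : ContDiffOn ℝ (⊤ : ℕ∞) (deriv α) (Set.Ioo a b) :=
    hsmooth.deriv_of_isOpen isOpen_Ioo (by simp)
  have hN : ContDiffOn ℝ (⊤ : ℕ∞) (Narc α) (Set.Ioo a b) :=
    hT.deriv_of_isOpen isOpen_Ioo (by simp)
  have dT : ∀ s ∈ Set.Ioo a b, HasDerivAt (deriv α) (Narc α s) s := fun s hs =>
    ((hT.differentiableOn (by simp)).differentiableAt (isOpen_Ioo.mem_nhds hs)).hasDerivAt
  have dN : ∀ s ∈ Set.Ioo a b, HasDerivAt (Narc α) (deriv (Narc α) s) s := fun s hs =>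
    ((hN.differentiableOn (by simp)).differentiableAt (isOpen_Ioo.mem_nhds hs)).hasDerivAt
  have hTN : ∀ s ∈ Set.Ioo a b, mink (deriv α s) (Narc α s) = 0 := by
    intro s hs
    have := mink_const_deriv hs hunit (mink_hasDerivAt (dT s hs) (dT s hs))
    simp only [mink] at this ⊢
    linarith
  have hNN' : ∀ s ∈ Set.Ioo a b, mink (deriv (Narc α) s) (Narc α s) = 0 := by
    intro s hs
    have := mink_const_deriv hs hcurv (mink_hasDerivAt (dN s hs) (dN s hs))
    simp only [mink] at this ⊢
    linarith
  have hTN' : ∀ s ∈ Set.Ioo a b, mink (deriv (Narc α) s) (deriv α s) = -1 := by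
    intro s hs
    have := mink_const_deriv hs hTN (mink_hasDerivAt (dT s hs) (dN s hs))
    have h2 := hcurv s hs
    simp only [mink] at this h2 ⊢
    linarith
  have hTB : ∀ s, mink (deriv α s) (Barc α s) = 0 := by
    intro s; simp [mink, Barc, lcross]; ring
  have hNB : ∀ s, mink (Narc α s) (Barc α s) = 0 := by
    intro s; simp [mink, Barc, lcross]; ring
  have hBB : ∀ s ∈ Set.Ioo a b, mink (Barc α s) (Barc α s) = 1 := by
    intro s hs
    have : mink (Barc α s) (Barc α s) = mink (deriv α s) (Narc α s) ^ 2
      - mink (deriv α s) (deriv α s) * mink (Narc α s) (Narc α s) := by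
      simp [mink, Barc, lcross]; ring
    rw [this, hTN s hs, hunit s hs, hcurv s hs]; norm_num
  have hN' : ∀ s ∈ Set.Ioo a b,
      deriv (Narc α) s = deriv α s + tauArc α s • Barc α s := by
    intro s hs
    rw [← sub_eq_zero]
    have e1 := hTN' s hs
    have e2 := hNN' s hs
    have e3 : mink (deriv (Narc α) s) (Barc α s) = tauArc α s := rfl
    have lin : ∀ w, mink (deriv (Narc α) s - (deriv α s + tauArc α s • Barc α s)) w
        = mink (deriv (Narc α) s) w - mink (deriv α s) w - tauArc α s * mink (Barc α s) w := by
      intro w; simp [mink]; ring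
    have comm : ∀ x y, mink x y = mink y x := by intro x y; simp [mink]; ring
    apply mink_eq_zero_aux (deriv α s) (Narc α s)
    · rw [lin, e1, hunit s hs, comm, hTB]; ring
    · rw [lin, e2, hTN s hs, comm, hNB]; ring
    · change mink _ (Barc α s) = 0
      rw [lin, e3, hTB, hBB s hs]; ring
    · exact hBB s hs
  have hB' : ∀ s ∈ Set.Ioo a b, HasDerivAt (Barc α) (-(tauArc α s) • Narc α s) s := by
    intro s hs
    have h := lcross_hasDerivAt (dT s hs) (dN s hs)
    change HasDerivAt (Barc α) _ s at h
    convert h using 1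
    rw [hN' s hs]
    have key : lcross (Narc α s) (Narc α s)
        + lcross (deriv α s) (deriv α s + tauArc α s • Barc α s)
        = tauArc α s • (mink (deriv α s) (deriv α s) • Narc α s
          - mink (deriv α s) (Narc α s) • deriv α s) := by
      generalize tauArc α s = t
      funext i
      fin_cases i <;> simp [mink, Barc, lcross] <;> ring
    rw [key, hunit s hs, hTN s hs]
    simp
  have htpos : 0 < Real.tanh φ := by
    rw [Real.tanh_eq_sinh_div_cosh]
    exact div_pos (Real.sinh_pos_iff.2 hφ) (Real.cosh_pos φ)
  have hpos : ∀ s ∈ Set.Ioo a b, 0 < s ^ 2 - Real.tanh φ ^ 2 := by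
    intro s hs
    have : Real.tanh φ < s := hI hs
    nlinarith
  have hd : ∀ s ∈ Set.Ioo a b,
      HasDerivAt (fun u : ℝ => Real.cosh φ •
        ((-u) • deriv α u + Narc α u
          - Real.sqrt (u ^ 2 - Real.tanh φ ^ 2) • Barc α u)) 0 s := by
    intro s hs
    have hp := hpos s hs
    have hr : HasDerivAt (fun u : ℝ => Real.sqrt (u ^ 2 - Real.tanh φ ^ 2)) (tauArc α s) s := by
      have := (((hasDerivAt_id s).pow 2).sub_const (Real.tanh φ ^ 2)).sqrt hp.ne'
      refine HasDerivAt.congr_deriv this ?_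
      rw [htau s hs]
      simp
      try field_simp
    have h := ((((hasDerivAt_id s).neg.smul (dT s hs)).add (dN s hs)).sub
      (hr.smul (hB' s hs))).const_smul (Real.cosh φ)
    refine HasDerivAt.congr_deriv h ?_
    have hrt : Real.sqrt (s ^ 2 - Real.tanh φ ^ 2) * tauArc α s = s := by
      rw [htau s hs]
      exact mul_div_cancel₀ _ (Real.sqrt_pos.2 hp).ne'
    rw [hN' s hs]
    funext i
    simp
    right
    linear_combination (Narc α s i) * hrt
  have lin2 : ∀ (c p q : ℝ) (x y z w : Fin 3 → ℝ),
      mink w (c • (p • x + y - q • z)) = c * (p * mink w x + mink w y - q * mink w z) := by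
    intros; simp [mink]; ring
  have comm : ∀ x y, mink x y = mink y x := by intro x y; simp [mink]; ring
  refine ⟨fun s hs => (hd s hs).deriv, ?_, ?_, ?_⟩
  · intro s hs s' hs'
    exact isOpen_Ioo.is_const_of_deriv_eq_zero isPreconnected_Ioo
      (fun u hu => (hd u hu).differentiableAt.differentiableWithinAt)
      (fun u hu => (hd u hu).deriv) hs hs'
  · intro s hs
    rw [lin2, comm _ (deriv α s), comm _ (Narc α s), comm _ (Barc α s), lin2, lin2, lin2,
      comm (Narc α s) (deriv α s), comm (Barc α s) (deriv α s), comm (Barc α s) (Narc α s),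
      hunit s hs, hTN s hs, hTB, hNB, hcurv s hs, hBB s hs]
    have h1 := Real.sq_sqrt (hpos s hs).le
    have h2 : Real.cosh φ ^ 2 * Real.tanh φ ^ 2 = Real.sinh φ ^ 2 := by
      rw [Real.tanh_eq_sinh_div_cosh]
      field_simp [(Real.cosh_pos φ).ne']
    have h3 := Real.cosh_sq φ
    linear_combination Real.cosh φ ^ 2 * h1 - h2 + h3
  · intro s hs
    rw [lin2, comm _ (deriv α s), hTN s hs, hNB, hcurv s hs]
    ring
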